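/- Let m ≥ 3 be an odd integer, let K be an imaginary quadratic field with K ≠ ℚ(√−3), and suppose γ ∈ K^× satisfies: (i) for every finite place v of K, v(γ) ≡ 0 (mod m); and (ii) the polynomial X^m − γ is irreducible over K. Then the ideal class group Cl(K) contains an element of order m, i.e. rank_m Cl(K) ≥ 1. -/

import Mathlib

open NumberField IsDedekindDomain

open scoped nonZeroDivisors

section DedekindDomain

variable {R : Type*} [CommRing R] [IsDedekindDomain R] {K : Type*} [Field K] [Algebra R K]
  [IsFractionRing R K]

/-- The multiplicity of a prime in a principal fractional ideal is minus the exponent of the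
valuation of a generator. -/
theorem count_spanSingleton_eq_neg_toAdd_valuationOfNeZero (v : HeightOneSpectrum R) (x : Kˣ) :
    FractionalIdeal.count K v (FractionalIdeal.spanSingleton R⁰ (x : K)) =
      -Multiplicative.toAdd (v.valuationOfNeZero x) := by
  classical
  obtain ⟨n, d, hd, hx⟩ := IsFractionRing.div_surjective (A := R) (x : K)
  have hd0 : d ≠ 0 := nonZeroDivisors.ne_zero hd
  have hn0 : n ≠ 0 := by
    rintro rfl
    exact x.ne_zero (by rw [← hx, map_zero, zero_div])
  have hspan : FractionalIdeal.spanSingleton R⁰ (x : K) =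
      FractionalIdeal.spanSingleton R⁰ ((algebraMap R K) d)⁻¹ * ↑(Ideal.span {n} : Ideal R) := by
    rw [FractionalIdeal.coeIdeal_span_singleton, FractionalIdeal.spanSingleton_mul_spanSingleton,
      ← hx, div_eq_mul_inv, mul_comm]
  rw [FractionalIdeal.count_well_defined K v
    (FractionalIdeal.spanSingleton_ne_zero_iff.mpr x.ne_zero) hspan]
  have hval := v.valuationOfNeZero_eq x
  rw [← hx, map_div₀, HeightOneSpectrum.valuation_of_algebraMap,
    HeightOneSpectrum.valuation_of_algebraMap, v.intValuation_if_neg hn0,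
    v.intValuation_if_neg hd0, ← WithZero.exp_sub] at hval
  have hcoe : v.valuationOfNeZero x = Multiplicative.ofAdd _ := WithZero.coe_inj.mp hval
  rw [hcoe, toAdd_ofAdd]
  ring

/-- A fractional ideal all of whose multiplicities are divisible by `m` is an `m`-th power. -/
theorem FractionalIdeal.exists_pow_eq_of_forall_dvd_count {m : ℕ} {I : FractionalIdeal R⁰ K}
    (hI : I ≠ 0) (h : ∀ v : HeightOneSpectrum R, (m : ℤ) ∣ FractionalIdeal.count K v I) :
    ∃ J : FractionalIdeal R⁰ K, J ^ m = I := by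
  choose e he using h
  by_cases hm : m = 0
  · refine ⟨1, ?_⟩
    rw [← FractionalIdeal.finprod_heightOneSpectrum_factorization' K hI]
    simp [he, hm]
  have hfin : Function.HasFiniteMulSupport
      fun v : HeightOneSpectrum R ↦ (v.asIdeal : FractionalIdeal R⁰ K) ^ e v := by
    refine (Filter.eventually_cofinite.mp (FractionalIdeal.finite_factors I)).subset ?_
    intro v hv hcount
    have : e v = 0 := by simpa [he, hm] using hcount
    exact hv (by simp [this])
  refine ⟨∏ᶠ v : HeightOneSpectrum R, (v.asIdeal : FractionalIdeal R⁰ K) ^ e v, ?_⟩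
  rw [finprod_pow hfin]
  conv_rhs => rw [← FractionalIdeal.finprod_heightOneSpectrum_factorization' K hI]
  refine finprod_congr fun v ↦ ?_
  rw [he, mul_comm, zpow_mul, zpow_natCast]

/-- An element whose valuations are all divisible by `m` generates the `m`-th power of an
invertible fractional ideal. -/
theorem exists_pow_eq_toPrincipalIdeal {m : ℕ} (hm : m ≠ 0) (x : Kˣ)
    (h : ∀ v : HeightOneSpectrum R, (m : ℤ) ∣ Multiplicative.toAdd (v.valuationOfNeZero x)) :
    ∃ J : (FractionalIdeal R⁰ K)ˣ, J ^ m = toPrincipalIdeal R K x := by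
  obtain ⟨J, hJ⟩ := FractionalIdeal.exists_pow_eq_of_forall_dvd_count (m := m)
    (FractionalIdeal.spanSingleton_ne_zero_iff.mpr x.ne_zero) fun v ↦ by
      rw [count_spanSingleton_eq_neg_toAdd_valuationOfNeZero (R := R)]
      exact (h v).neg_right
  have hJ0 : J ≠ 0 := by
    rintro rfl
    rw [zero_pow hm] at hJ
    exact FractionalIdeal.spanSingleton_ne_zero_iff.mpr x.ne_zero hJ.symm
  refine ⟨Units.mk0 J hJ0, Units.ext ?_⟩
  simpa using hJ

/-- Two generators of the same principal fractional ideal differ by a unit. -/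
theorem exists_unit_mul_eq_of_toPrincipalIdeal_eq {x y : Kˣ}
    (h : toPrincipalIdeal R K x = toPrincipalIdeal R K y) :
    ∃ u : Rˣ, algebraMap R K u * x = y := by
  have h' : FractionalIdeal.spanSingleton R⁰ (x : K) =
      FractionalIdeal.spanSingleton R⁰ (y : K) := by
    simpa using congrArg Units.val h
  obtain ⟨u, hu⟩ := FractionalIdeal.spanSingleton_eq_spanSingleton.mp h'
  exact ⟨u, by rw [← hu, Units.smul_def, Algebra.smul_def]⟩

end DedekindDomain

section ImaginaryQuadratic

variable {K : Type*} [Field K] [NumberField K]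

/-- Units of an imaginary quadratic field are roots of unity. -/
theorem isOfFinOrder_unit_of_finrank_eq_two [IsTotallyComplex K]
    (hdeg : Module.finrank ℚ K = 2) (u : (𝓞 K)ˣ) : IsOfFinOrder u := by
  have hrank : Units.rank K = 0 := by
    have := IsTotallyComplex.finrank (K := K)
    rw [Units.rank, InfinitePlace.card_eq_nrRealPlaces_add_nrComplexPlaces,
      IsTotallyComplex.nrRealPlaces_eq_zero]
    omega
  have : IsEmpty (Fin (Units.rank K)) := by rw [hrank]; infer_instance
  have htop := Units.closure_fundSystem_sup_torsion_eq_top (K := K)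
  rw [Set.range_eq_empty, Subgroup.closure_empty, bot_sup_eq] at htop
  exact (CommGroup.mem_torsion _).mp (htop ▸ Subgroup.mem_top u : u ∈ Units.torsion K)

/-- A quadratic field without a square root of `-3` has no roots of unity of odd prime order. -/
theorem not_isPrimitiveRoot_of_finrank_eq_two (hdeg : Module.finrank ℚ K = 2)
    (hK3 : ∀ z : K, z ^ 2 ≠ -3) {p : ℕ} (hp : p.Prime) (hp2 : p ≠ 2) (ζ : K) :
    ¬ IsPrimitiveRoot ζ p := by
  intro hζ
  have hle := hζ.lcm_totient_le_finrank hζ (K := ℚ)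
    (by rw [Nat.lcm_self]; exact Polynomial.cyclotomic.irreducible_rat hp.pos)
  rw [Nat.lcm_self, hdeg, Nat.totient_prime hp] at hle
  have h2 := hp.two_le
  obtain rfl : p = 3 := by omega
  have hsum := hζ.geom_sum_eq_zero (by norm_num)
  simp only [Finset.sum_range_succ, Finset.sum_range_zero] at hsum
  exact hK3 (2 * ζ + 1) (by linear_combination 4 * hsum)

/-- In an imaginary quadratic field other than `ℚ(√-3)`, every unit is an `e`-th power for every
odd `e`. -/
theorem exists_pow_eq_unit_of_odd [IsTotallyComplex K] (hdeg : Module.finrank ℚ K = 2)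
    (hK3 : ∀ z : K, z ^ 2 ≠ -3) {e : ℕ} (he : Odd e) (u : (𝓞 K)ˣ) :
    ∃ w : (𝓞 K)ˣ, w ^ e = u := by
  have hcop : e.Coprime (orderOf u) := by
    refine Nat.Coprime.symm (Nat.coprime_of_dvd fun p hp hpu hpe ↦ ?_)
    have hp2 : p ≠ 2 := by
      rintro rfl
      exact Nat.not_even_iff_odd.mpr he (even_iff_two_dvd.mpr hpe)
    have hpos := (isOfFinOrder_unit_of_finrank_eq_two hdeg u).orderOf_pos
    obtain ⟨k, hk⟩ := hpu
    have hroot : IsPrimitiveRoot (u ^ k) p :=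
      (IsPrimitiveRoot.orderOf u).pow hpos (by rw [hk, mul_comm])
    exact not_isPrimitiveRoot_of_finrank_eq_two hdeg hK3 hp hp2 _
      (hroot.map_of_injective (f := (algebraMap (𝓞 K) K : 𝓞 K →* K).comp (Units.coeHom (𝓞 K)))
        (Units.coe_injective K))
  obtain ⟨k, hk⟩ := exists_pow_eq_self_of_coprime hcop
  exact ⟨u ^ k, by rw [pow_right_comm, hk]⟩

end ImaginaryQuadratic

/-- Let `m ≥ 3` be odd and let `K` be an imaginary quadratic field with
`K ≠ ℚ(√−3)`. If `γ ∈ K^×` has `v(γ) ≡ 0 (mod m)` at every finite place `v`, and `X^m − γ` is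
irreducible over `K`, then `Cl(K)` contains an element of order `m`. -/
theorem imaginary_quadratic_order_m_class (m : ℕ) (hm : 3 ≤ m) (hmodd : Odd m)
    (K : Type*) [Field K] [NumberField K]
    (hdeg : Module.finrank ℚ K = 2)
    (himag : ∀ φ : K →+* ℂ, ∃ a : K, (φ a).im ≠ 0)
    (hK3 : ∀ z : K, z ^ 2 ≠ -3)
    (γ : Kˣ)
    (hval : ∀ v : HeightOneSpectrum (𝓞 K),
      (m : ℤ) ∣ Multiplicative.toAdd (v.valuationOfNeZero γ))
    (hirr : Irreducible ((Polynomial.X : Polynomial K) ^ m - Polynomial.C (γ : K))) :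
    ∃ C : ClassGroup (𝓞 K), orderOf C = m := by
  have hm0 : m ≠ 0 := by omega
  have : IsTotallyComplex K := ⟨fun w ↦ by
    rw [← InfinitePlace.not_isReal_iff_isComplex, InfinitePlace.isReal_iff]
    intro hreal
    obtain ⟨a, ha⟩ := himag w.embedding
    exact ha (Complex.conj_eq_iff_im.mp (RingHom.congr_fun hreal a))⟩
  obtain ⟨J, hJ⟩ := exists_pow_eq_toPrincipalIdeal hm0 γ hval
  let q : (FractionalIdeal (𝓞 K)⁰ K)ˣ ⧸ (toPrincipalIdeal (𝓞 K) K).range := J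
  refine ⟨(ClassGroup.equiv K).symm q, ?_⟩
  rw [MulEquiv.orderOf_eq]
  have hdvd : orderOf q ∣ m := orderOf_dvd_of_pow_eq_one <|
    (QuotientGroup.eq_one_iff (J ^ m)).mpr ⟨γ, hJ.symm⟩
  obtain ⟨e, he⟩ := hdvd
  obtain ⟨α, hα⟩ := (QuotientGroup.eq_one_iff (J ^ orderOf q)).mp (pow_orderOf_eq_one q)
  obtain ⟨u, hu⟩ := exists_unit_mul_eq_of_toPrincipalIdeal_eq
    (x := α ^ e) (y := γ) (by rw [map_pow, hα, ← pow_mul, ← he, hJ])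
  obtain ⟨w, hw⟩ := exists_pow_eq_unit_of_odd hdeg hK3
    (Nat.Odd.of_mul_right (he ▸ hmodd)) u
  by_contra hne
  refine pow_ne_of_irreducible_X_pow_sub_C hirr (Dvd.intro_left _ he.symm) ?_
    (algebraMap (𝓞 K) K w * α) ?_
  · rintro rfl
    exact hne (by rw [he, mul_one])
  · rw [mul_pow, ← hu, ← hw, Units.val_pow_eq_pow_val, Units.val_pow_eq_pow_val, map_pow]
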